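/- Let X → Y be a map of bisimplicial sets such that for every k the map of simplicial sets X_{k,•} → Y_{k,•} is a weak homotopy equivalence. Then the induced map on diagonals diag X → diag Y is a weak homotopy equivalence. -/

import Mathlib

open CategoryTheory CategoryTheory.Limits Simplicial MonoidalCategory SSet

noncomputable instance : MonoidalClosed SSet.{0} :=
  (inferInstance : MonoidalClosed (SimplexCategoryᵒᵖ ⥤ Type 0))

namespace Paper

/-- A map of simplicial sets is a *trivial fibration* if it has the right lifting
property with respect to all boundary inclusions `∂Δ[n] ⟶ Δ[n]` for `n ≥ 0`. -/
def TrivialFibration {X Y : SSet.{0}} (p : X ⟶ Y) : Prop :=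
  ∀ n : ℕ, HasLiftingProperty (SSet.boundary n).ι p

/-- A map of simplicial sets is a *Kan fibration* if it has the right lifting property
with respect to all horn inclusions `Λ[n, i] ⟶ Δ[n]` for `n ≥ 1`, `0 ≤ i ≤ n`. -/
def KanFibration {X Y : SSet.{0}} (p : X ⟶ Y) : Prop :=
  ∀ (n : ℕ) (i : Fin (n + 2)), HasLiftingProperty (SSet.horn (n + 1) i).ι p

/-- An *anodyne* map is one with the left lifting property with respect to
all Kan fibrations. -/
def Anodyne {A B : SSet.{0}} (i : A ⟶ B) : Prop :=
  ∀ ⦃X Y : SSet.{0}⦄ (p : X ⟶ Y), KanFibration p → HasLiftingProperty i p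

/-- The unique map to `Δ[0]`. -/
def toPt (X : SSet.{0}) : X ⟶ Δ[0] where
  app m := ↾fun _ => SSet.stdSimplex.const 0 0 m
  naturality := by
    intro m m' φ
    refine ConcreteCategory.hom_ext _ _ fun x => ?_
    apply stdSimplex.objEquiv.injective
    apply SimplexCategory.Hom.ext
    apply OrderHom.ext
    funext j
    exact @Subsingleton.elim (Fin 1) _ _ _

/-- A *Kan complex* is a simplicial set whose map to `Δ[0]` is a Kan fibration. -/
def KanComplex (X : SSet.{0}) : Prop :=
  KanFibration (toPt X)

/-- The constant map at the vertex `k` of `Δ[1]`. -/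
def cst (X : SSet.{0}) (k : Fin 2) : X ⟶ Δ[1] where
  app m := ↾fun _ => SSet.stdSimplex.const 1 k m
  naturality := by
    intro m m' φ
    refine ConcreteCategory.hom_ext _ _ fun x => ?_
    apply stdSimplex.objEquiv.injective
    apply SimplexCategory.Hom.ext
    ext j
    rfl

/-- The endpoint inclusion `X ⟶ X ⊗ Δ[1]` at the vertex `k` of `Δ[1]`. -/
noncomputable def ept (X : SSet.{0}) (k : Fin 2) : X ⟶ X ⊗ Δ[1] :=
  CartesianMonoidalCategory.lift (𝟙 X) (cst X k)

/-- A (single-step) homotopy from `f` to `g`, as a property of the pair `(f, g)`. -/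
def Homotopy {X Y : SSet.{0}} (f g : X ⟶ Y) : Prop :=
  ∃ H : X ⊗ Δ[1] ⟶ Y, ept X 0 ≫ H = f ∧ ept X 1 ≫ H = g

/-- `f` and `g` are *homotopic* if they are connected by a zig-zag of homotopies. -/
def Homotopic {X Y : SSet.{0}} (f g : X ⟶ Y) : Prop :=
  Relation.EqvGen Homotopy f g

/-- A *homotopy equivalence* of simplicial sets. -/
def HomotopyEquivalence {X Y : SSet.{0}} (f : X ⟶ Y) : Prop :=
  ∃ g : Y ⟶ X, Homotopic (f ≫ g) (𝟙 X) ∧ Homotopic (g ≫ f) (𝟙 Y)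

/-- A map `f : X ⟶ Y` is a *weak homotopy equivalence* if for every Kan complex `K`
the induced map `K^Y ⟶ K^X` on exponentials is a homotopy equivalence. -/
def WeakHomotopyEquivalence {X Y : SSet.{0}} (f : X ⟶ Y) : Prop :=
  ∀ K : SSet.{0}, KanComplex K → HomotopyEquivalence ((MonoidalClosed.pre f).app K)

/-- A homotopy `H` between maps over `B` which is *fiberwise over `B`*. -/
def FibHomotopy {B X Y : SSet.{0}} (pX : X ⟶ B) (pY : Y ⟶ B) (f g : X ⟶ Y) : Prop :=
  ∃ H : X ⊗ Δ[1] ⟶ Y, ept X 0 ≫ H = f ∧ ept X 1 ≫ H = g ∧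
    H ≫ pY = CartesianMonoidalCategory.fst X Δ[1] ≫ pX

/-- Connectedness by a zig-zag of fiberwise homotopies over `B`. -/
def FibHomotopic {B X Y : SSet.{0}} (pX : X ⟶ B) (pY : Y ⟶ B) (f g : X ⟶ Y) : Prop :=
  Relation.EqvGen (FibHomotopy pX pY) f g

/-- A *fiberwise homotopy equivalence over `B`*. -/
def FibHomotopyEquivalence {B X Y : SSet.{0}} (pX : X ⟶ B) (pY : Y ⟶ B) (f : X ⟶ Y) : Prop :=
  f ≫ pY = pX ∧ ∃ g : Y ⟶ X, g ≫ pX = pY ∧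
    FibHomotopic pX pX (f ≫ g) (𝟙 X) ∧ FibHomotopic pY pY (g ≫ f) (𝟙 Y)

end Paper


namespace Paper

/-- The diagonal of a bisimplicial set (a simplicial object in simplicial sets). -/
def diag (X : SimplicialObject SSet.{0}) : SSet.{0} where
  obj n := (X.obj n).obj n
  map {n m} φ := ↾fun x => (X.map φ).app m ((X.obj n).map φ x)
  map_id n := by
    refine ConcreteCategory.hom_ext _ _ fun x => ?_
    simp
  map_comp {n m k} φ ψ := by
    refine ConcreteCategory.hom_ext _ _ fun x => ?_
    dsimp
    rw [X.map_comp, Functor.map_comp_apply, NatTrans.comp_app, types_comp_apply,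
      NatTrans.naturality_apply]

/-- The map induced on diagonals by a map of bisimplicial sets. -/
def diagMap {X Y : SimplicialObject SSet.{0}} (f : X ⟶ Y) : diag X ⟶ diag Y where
  app n := ↾fun x => (f.app n).app n x
  naturality := by
    intro n m φ
    refine ConcreteCategory.hom_ext _ _ fun x => ?_
    exact (ConcreteCategory.congr_hom (congrArg (fun t => t.app m) (f.naturality φ))
      ((X.obj n).map φ x)).trans
      (congrArg (fun y => (Y.map φ).app m y) (NatTrans.naturality_apply (f.app n) φ x))

end Paper

namespace Paper

open HomotopicalAlgebra SSet.modelCategoryQuillen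

section Basic

lemma kanFibration_iff {X Y : SSet.{0}} (p : X ⟶ Y) : KanFibration p ↔ Fibration p := by
  rw [fibration_iff]
  constructor
  · intro h _ _ _ hi
    simp only [J, MorphismProperty.iSup_iff] at hi
    obtain ⟨m, ⟨k⟩⟩ := hi
    exact h m k
  · intro h n i
    exact h _ (horn_ι_mem_J (n + 1) i)

/-- The one-point simplicial set `Δ[0]` is terminal. -/
def isTerminalPt : IsTerminal (Δ[0] : SSet.{0}) :=
  IsTerminal.ofUniqueHom toPt (fun X m => by ext)

lemma kanComplex_iff (X : SSet.{0}) : KanComplex X ↔ SSet.KanComplex X := by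
  rw [KanComplex, kanFibration_iff]
  refine Iff.trans ?_ (isFibrant_iff X).symm
  have e : Arrow.mk (toPt X) ≅ Arrow.mk (terminal.from X) :=
    Arrow.isoMk (Iso.refl _) (isTerminalPt.uniqueUpToIso terminalIsTerminal)
      (terminal.hom_ext _ _)
  rw [HomotopicalAlgebra.fibration_iff, HomotopicalAlgebra.fibration_iff]
  exact (fibrations SSet).arrow_mk_iso_iff e

lemma ept_fst (X : SSet.{0}) (k : Fin 2) :
    ept X k ≫ CartesianMonoidalCategory.fst X Δ[1] = 𝟙 X := by
  simp [ept]

lemma ept_fst_assoc (X : SSet.{0}) (k : Fin 2) {Z : SSet.{0}} (g : X ⟶ Z) :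
    ept X k ≫ CartesianMonoidalCategory.fst X Δ[1] ≫ g = g := by
  rw [← Category.assoc, ept_fst, Category.id_comp]

lemma ept_naturality_assoc {X Y : SSet.{0}} (f : X ⟶ Y) (k : Fin 2) {Z : SSet.{0}}
    (g : Y ⊗ Δ[1] ⟶ Z) : f ≫ ept Y k ≫ g = ept X k ≫ f ▷ Δ[1] ≫ g := by
  rfl

lemma fin_two_eq_one_sub : ∀ {k e : Fin 2}, k ≠ e → k = 1 - e := by decide

lemma fin_two_one_sub_ne : ∀ e : Fin 2, 1 - e ≠ e := by decide

/-- The face of `Δ[1]` opposite to the vertex `e`, numbered by that vertex. -/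
lemma whiskerLeft_δ (X : SSet.{0}) (e : Fin 2) :
    X ◁ stdSimplex.δ (1 - e) = CartesianMonoidalCategory.fst X Δ[0] ≫ ept X e := by
  refine CartesianMonoidalCategory.hom_ext _ _ (by simp [ept]) ?_
  simp only [CartesianMonoidalCategory.whiskerLeft_snd, Category.assoc]
  have h₁ : CartesianMonoidalCategory.fst X Δ[0] ≫ ept X e ≫
      CartesianMonoidalCategory.snd X Δ[1] =
      CartesianMonoidalCategory.snd X Δ[0] ≫ cst Δ[0] e := rfl
  rw [h₁]
  congr 1
  apply yonedaEquiv.injective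
  apply stdSimplex.objEquiv.injective
  apply SimplexCategory.Hom.ext
  apply OrderHom.ext
  funext i
  obtain rfl : i = 0 := Subsingleton.elim (α := Fin 1) _ _
  clear h₁
  revert e
  change ∀ e : Fin 2, (SimplexCategory.δ (1 - e)).toOrderHom 0 = e
  decide

/-- Lifting property of the endpoint inclusions, relative to a monomorphism. -/
lemma exists_homotopy_extension {C D E B : SSet.{0}} (j : C ⟶ D) [Mono j] (p : E ⟶ B)
    [Fibration p] (e : Fin 2) (H : C ⊗ Δ[1] ⟶ E) (a : D ⟶ E) (G : D ⊗ Δ[1] ⟶ B)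
    (h₁ : j ≫ a = ept C e ≫ H) (h₂ : H ≫ p = j ▷ Δ[1] ≫ G) (h₃ : a ≫ p = ept D e ≫ G) :
    ∃ F : D ⊗ Δ[1] ⟶ E, j ▷ Δ[1] ≫ F = H ∧ ept D e ≫ F = a ∧ F ≫ p = G := by
  let sq := Functor.PushoutObjObj.ofHasPushout (curriedTensor SSet.{0}) j
    (stdSimplex.δ (1 - e) : Δ[0] ⟶ Δ[1])
  have hδ : anodyneExtensions (stdSimplex.δ (1 - e) : Δ[0] ⟶ Δ[1]) := by
    intro E B p hp
    rw [← HomotopicalAlgebra.fibration_iff] at hp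
    refine ⟨fun {a G} w => ?_⟩
    obtain ⟨φ, h₁, h₂⟩ := horn.IsCompatible.exists_lift (i := e) (f := fun _ _ => a)
      (by simp) p G (fun k hk => by
        obtain rfl : k = 1 - e := fin_two_eq_one_sub hk
        exact w.w)
    exact ⟨⟨⟨φ, h₁ _ (fin_two_one_sub_ne e), h₂⟩⟩⟩
  have hsq := anodyneExtensions_pushoutObjObjι sq hδ p (by
    rwa [← HomotopicalAlgebra.fibration_iff])
  have w₀ : ((curriedTensor SSet.{0}).map j).app Δ[0] ≫
      CartesianMonoidalCategory.fst D Δ[0] ≫ a =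
      ((curriedTensor SSet.{0}).obj C).map (stdSimplex.δ (1 - e)) ≫ H := by
    change j ▷ Δ[0] ≫ CartesianMonoidalCategory.fst D Δ[0] ≫ a = C ◁ stdSimplex.δ (1 - e) ≫ H
    rw [whiskerLeft_δ, Category.assoc, ← h₁]
    rfl
  have w₁ : sq.isPushout.desc (CartesianMonoidalCategory.fst D Δ[0] ≫ a) H w₀ ≫ p =
      sq.ι ≫ G := by
    apply sq.isPushout.hom_ext
    · rw [IsPushout.inl_desc_assoc, sq.inl_ι_assoc, Category.assoc, h₃]
      change _ = D ◁ stdSimplex.δ (1 - e) ≫ G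
      rw [whiskerLeft_δ, Category.assoc]
    · rw [IsPushout.inr_desc_assoc, sq.inr_ι_assoc]
      exact h₂
  have w : CommSq (sq.isPushout.desc (CartesianMonoidalCategory.fst D Δ[0] ≫ a) H w₀) sq.ι p G :=
    ⟨w₁⟩
  refine ⟨w.lift, ?_, ?_, w.fac_right⟩
  · have := sq.inr ≫= w.fac_left
    rw [sq.inr_ι_assoc, IsPushout.inr_desc] at this
    exact this
  · have := sq.inl ≫= w.fac_left
    rw [sq.inl_ι_assoc, IsPushout.inl_desc] at this
    have h₄ : D ◁ stdSimplex.δ (1 - e) ≫ w.lift = CartesianMonoidalCategory.fst D Δ[0] ≫ a := this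
    rw [whiskerLeft_δ, Category.assoc] at h₄
    have h₅ := CartesianMonoidalCategory.lift (𝟙 D) (toPt D) ≫= h₄
    simpa using h₅

lemma anodyne_ept (X : SSet.{0}) (e : Fin 2) : anodyneExtensions (ept X e) := by
  intro E B p hp
  rw [← HomotopicalAlgebra.fibration_iff] at hp
  refine ⟨fun {a G} sq => ?_⟩
  have hI : IsInitial ((⊥_ SSet.{0}) ⊗ Δ[1]) :=
    IsInitial.isInitialObj ((curriedTensor SSet.{0}).flip.obj Δ[1]) _ initialIsInitial
  obtain ⟨F, -, h₁, h₂⟩ := exists_homotopy_extension (initial.to X) p e (hI.to E)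
    a G (initialIsInitial.hom_ext _ _) (hI.hom_ext _ _) sq.w
  exact ⟨⟨⟨F, h₁, h₂⟩⟩⟩

end Basic

section Homotopies

open CartesianMonoidalCategory MonoidalClosed

lemma ept_comp_of_whiskerLeft_δ {X Y : SSet.{0}} (e : Fin 2) (H : X ⊗ Δ[1] ⟶ Y) (f : X ⟶ Y)
    (h : X ◁ stdSimplex.δ (1 - e) ≫ H = fst X Δ[0] ≫ f) : ept X e ≫ H = f := by
  rw [whiskerLeft_δ, Category.assoc] at h
  have h₅ := lift (𝟙 X) (toPt X) ≫= h
  simpa using h₅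

lemma exists_homotopy_of_homotopies {X E B : SSet.{0}} (p : E ⟶ B) [Fibration p]
    (H K : X ⊗ Δ[1] ⟶ E) (h : ept X 1 ≫ K = ept X 1 ≫ H) (hp : H ≫ p = K ≫ p) :
    ∃ L : X ⊗ Δ[1] ⟶ E, ept X 0 ≫ L = ept X 0 ≫ H ∧ ept X 1 ≫ L = ept X 0 ≫ K ∧
      L ≫ p = fst X Δ[1] ≫ ept X 0 ≫ H ≫ p := by
  have hδ {Z : SSet.{0}} (e : Fin 2) (M : X ⊗ Δ[1] ⟶ Z) :
      stdSimplex.δ (1 - e) ≫ curry M = curry (fst X Δ[0] ≫ ept X e ≫ M) := by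
    rw [← curry_natural_left, whiskerLeft_δ, Category.assoc]
  let f (j : Fin 3) (_ : j ≠ 2) : Δ[1] ⟶ (ihom X).obj E := if j = 0 then curry K else curry H
  have hf : horn.IsCompatible f := by
    rw [horn.isCompatible_iff]
    intro j k hj hk hjk
    obtain rfl : j = 0 := by lia
    obtain rfl : k = 1 := by lia
    change stdSimplex.δ (1 - 1) ≫ curry K = stdSimplex.δ (1 - 1) ≫ curry H
    rw [hδ, hδ, h]
  obtain ⟨φ, h₁, h₂⟩ := hf.exists_lift ((ihom X).map p) (stdSimplex.σ 0 ≫ curry (H ≫ p)) (by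
    intro j hj
    obtain rfl | rfl : j = 0 ∨ j = 1 := by lia
    · have : stdSimplex.δ (0 : Fin 3) ≫ stdSimplex.σ (0 : Fin 2) = 𝟙 (Δ[1] : SSet.{0}) :=
        CosimplicialObject.δ_comp_σ_self (X := SSet.stdSimplex.{0}) (i := 0)
      rw [reassoc_of% this, hp, curry_natural_right]
      rfl
    · have : stdSimplex.δ (1 : Fin 3) ≫ stdSimplex.σ (0 : Fin 2) = 𝟙 (Δ[1] : SSet.{0}) :=
        CosimplicialObject.δ_comp_σ_succ (X := SSet.stdSimplex.{0}) (i := 0)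
      rw [reassoc_of% this, curry_natural_right]
      rfl)
  have e₀ : stdSimplex.δ (0 : Fin 3) ≫ φ = curry K := h₁ 0 (by decide)
  have e₁ : stdSimplex.δ (1 : Fin 3) ≫ φ = curry H := h₁ 1 (by decide)
  have s₀ : stdSimplex.δ (1 : Fin 2) ≫ stdSimplex.δ (2 : Fin 3) =
      stdSimplex.δ (1 : Fin 2) ≫ (stdSimplex.δ (1 : Fin 3) : (Δ[1] : SSet.{0}) ⟶ Δ[2]) :=
    (CosimplicialObject.δ_comp_δ (X := SSet.stdSimplex.{0}) (i := (1 : Fin 2)) (j := 1) le_rfl)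
  have s₁ : stdSimplex.δ (0 : Fin 2) ≫ stdSimplex.δ (2 : Fin 3) =
      stdSimplex.δ (1 : Fin 2) ≫ (stdSimplex.δ (0 : Fin 3) : (Δ[1] : SSet.{0}) ⟶ Δ[2]) :=
    (CosimplicialObject.δ_comp_δ (X := SSet.stdSimplex.{0}) (i := (0 : Fin 2)) (j := 1)
      (by decide))
  have s₂ : stdSimplex.δ (2 : Fin 3) ≫ stdSimplex.σ (0 : Fin 2) =
      stdSimplex.σ (0 : Fin 1) ≫ (stdSimplex.δ (1 : Fin 2) : (Δ[0] : SSet.{0}) ⟶ Δ[1]) :=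
    (CosimplicialObject.δ_comp_σ_of_gt (X := SSet.stdSimplex.{0}) (i := (1 : Fin 2)) (j := 0)
      (by decide))
  refine ⟨uncurry (stdSimplex.δ 2 ≫ φ), ?_, ?_, ?_⟩
  · apply ept_comp_of_whiskerLeft_δ
    rw [← uncurry_natural_left]
    apply curry_injective
    rw [curry_uncurry]
    change stdSimplex.δ (1 : Fin 2) ≫ stdSimplex.δ (2 : Fin 3) ≫ φ = _
    rw [reassoc_of% s₀, e₁]
    exact hδ 0 H
  · apply ept_comp_of_whiskerLeft_δ
    rw [← uncurry_natural_left]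
    apply curry_injective
    rw [curry_uncurry]
    change stdSimplex.δ (0 : Fin 2) ≫ stdSimplex.δ (2 : Fin 3) ≫ φ = _
    rw [reassoc_of% s₁, e₀]
    exact hδ 0 K
  · rw [← uncurry_natural_right]
    apply curry_injective
    rw [curry_uncurry, Category.assoc, h₂, reassoc_of% s₂]
    refine (stdSimplex.σ (0 : Fin 1) ≫= hδ 0 (H ≫ p)).trans ?_
    rw [← curry_natural_left]
    simp

lemma Homotopy.refl {X Y : SSet.{0}} (f : X ⟶ Y) : Homotopy f f :=
  ⟨fst X Δ[1] ≫ f, by simp [ept_fst_assoc], by simp [ept_fst_assoc]⟩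

lemma Homotopy.euclidean {X Y : SSet.{0}} [SSet.KanComplex Y] {f g h : X ⟶ Y}
    (H : Homotopy f h) (K : Homotopy g h) : Homotopy f g := by
  obtain ⟨H, rfl, hH⟩ := H
  obtain ⟨K, rfl, hK⟩ := K
  obtain ⟨L, h₁, h₂, -⟩ := exists_homotopy_of_homotopies (terminal.from Y) H K
    (hK.trans hH.symm) (terminal.hom_ext _ _)
  exact ⟨L, h₁, h₂⟩

lemma Homotopy.symm {X Y : SSet.{0}} [SSet.KanComplex Y] {f g : X ⟶ Y}
    (H : Homotopy f g) : Homotopy g f :=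
  (Homotopy.refl g).euclidean H

lemma Homotopic.homotopy {X Y : SSet.{0}} [SSet.KanComplex Y] {f g : X ⟶ Y}
    (H : Homotopic f g) : Homotopy f g := by
  induction H with
  | rel _ _ h => exact h
  | refl => exact Homotopy.refl _
  | symm _ _ _ h => exact h.symm
  | trans _ _ _ _ _ h₁ h₂ => exact h₁.euclidean h₂.symm

lemma Homotopic.of_homotopy {X Y : SSet.{0}} {f g : X ⟶ Y} (h : Homotopy f g) :
    Homotopic f g := .rel _ _ h

lemma Homotopy.comp {X Y W Z : SSet.{0}} {f g : X ⟶ Y} (a : W ⟶ X) (b : Y ⟶ Z)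
    (h : Homotopy f g) : Homotopy (a ≫ f ≫ b) (a ≫ g ≫ b) := by
  obtain ⟨H, rfl, rfl⟩ := h
  exact ⟨a ▷ Δ[1] ≫ H ≫ b, by simp [← ept_naturality_assoc],
    by simp [← ept_naturality_assoc]⟩

lemma Homotopic.comp {X Y W Z : SSet.{0}} {f g : X ⟶ Y} (a : W ⟶ X) (b : Y ⟶ Z)
    (h : Homotopic f g) : Homotopic (a ≫ f ≫ b) (a ≫ g ≫ b) := by
  induction h with
  | rel _ _ h => exact .rel _ _ (h.comp a b)
  | refl => exact .refl _
  | symm _ _ _ h => exact .symm _ _ h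
  | trans _ _ _ _ _ h₁ h₂ => exact .trans _ _ _ h₁ h₂

lemma Homotopic.of_eq {X Y : SSet.{0}} {f g : X ⟶ Y} (h : f = g) : Homotopic f g := by
  subst h
  exact .refl _

lemma Homotopic.trans {X Y : SSet.{0}} {f g h : X ⟶ Y} (h₁ : Homotopic f g)
    (h₂ : Homotopic g h) : Homotopic f h :=
  Relation.EqvGen.trans _ _ _ h₁ h₂

lemma Homotopic.symm {X Y : SSet.{0}} {f g : X ⟶ Y} (h : Homotopic f g) : Homotopic g f :=
  Relation.EqvGen.symm _ _ h

lemma HomotopyEquivalence.of_comp_left {X Y Z : SSet.{0}} {f : X ⟶ Y} {g : Y ⟶ Z}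
    (hg : HomotopyEquivalence g) (hfg : HomotopyEquivalence (f ≫ g)) :
    HomotopyEquivalence f := by
  obtain ⟨g', h₁, h₂⟩ := hg
  obtain ⟨k, h₃, h₄⟩ := hfg
  refine ⟨g ≫ k, by simpa using h₃, ?_⟩
  have e₁ : Homotopic ((g ≫ k) ≫ f) ((g ≫ (k ≫ f ≫ g)) ≫ g') :=
    .symm (by simpa using Homotopic.comp ((g ≫ k) ≫ f) (𝟙 _) h₁)
  have e₂ : Homotopic ((g ≫ (k ≫ f ≫ g)) ≫ g') (g ≫ g') := by
    simpa using Homotopic.comp g g' h₄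
  exact .trans e₁ (.trans e₂ h₁)

lemma HomotopyEquivalence.of_comp_right {X Y Z : SSet.{0}} {f : X ⟶ Y} {g : Y ⟶ Z}
    (hf : HomotopyEquivalence f) (hfg : HomotopyEquivalence (f ≫ g)) :
    HomotopyEquivalence g := by
  obtain ⟨f', h₁, h₂⟩ := hf
  obtain ⟨k, h₃, h₄⟩ := hfg
  refine ⟨k ≫ f, ?_, by simpa using h₄⟩
  have e₁ : Homotopic (g ≫ k ≫ f) (f' ≫ (f ≫ g ≫ k) ≫ f) :=
    .symm (by simpa using Homotopic.comp (𝟙 _) (g ≫ k ≫ f) h₂)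
  have e₂ : Homotopic (f' ≫ (f ≫ g ≫ k) ≫ f) (f' ≫ f) := by
    simpa using Homotopic.comp f' f h₃
  exact .trans e₁ (.trans e₂ h₂)

lemma HomotopyEquivalence.comp {X Y Z : SSet.{0}} {f : X ⟶ Y} {g : Y ⟶ Z}
    (hf : HomotopyEquivalence f) (hg : HomotopyEquivalence g) :
    HomotopyEquivalence (f ≫ g) := by
  obtain ⟨f', h₁, h₂⟩ := hf
  obtain ⟨g', h₃, h₄⟩ := hg
  refine ⟨g' ≫ f', ?_, ?_⟩
  · exact .trans (by simpa using Homotopic.comp f f' h₃) h₁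
  · exact .trans (by simpa using Homotopic.comp g' g h₂) h₄

/-- A fibration between Kan complexes which is a homotopy equivalence has the right lifting
property with respect to monomorphisms. -/
lemma HomotopyEquivalence.rlp_monomorphisms {E B : SSet.{0}} (p : E ⟶ B) [Fibration p]
    [SSet.KanComplex E] [SSet.KanComplex B] (hp : HomotopyEquivalence p) :
    (MorphismProperty.monomorphisms SSet.{0}).rlp p := by
  obtain ⟨g, h₁, h₂⟩ := hp
  obtain ⟨G, hG₀, hG₁⟩ := h₂.homotopy
  obtain ⟨S, hS₀, hS₁⟩ : ∃ S : B ⊗ Δ[1] ⟶ E, ept B 0 ≫ S = g ∧ S ≫ p = G := by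
    have sq : CommSq g (ept B 0) p G := ⟨hG₀.symm⟩
    have := anodyne_ept B 0 p (by rwa [← HomotopicalAlgebra.fibration_iff])
    exact ⟨sq.lift, sq.fac_left, sq.fac_right⟩
  let s := ept B 1 ≫ S
  have hs : s ≫ p = 𝟙 B := by simp [s, hS₁, hG₁]
  have hgs : Homotopy g s := ⟨S, hS₀, rfl⟩
  have h₃ : Homotopic (𝟙 E) (p ≫ s) :=
    .trans (.symm h₁) (by simpa using Homotopic.comp p (𝟙 _) (.of_homotopy hgs))
  obtain ⟨H, hH₀, hH₁⟩ := h₃.homotopy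
  obtain ⟨L, hL₀, hL₁, hL⟩ := exists_homotopy_of_homotopies p H (H ≫ p ≫ s)
    (by simp [reassoc_of% hH₁, reassoc_of% hs, hH₁]) (by simp [hs])
  rw [hH₀] at hL₀
  rw [reassoc_of% hH₀] at hL hL₁
  intro C D i hi
  have : Mono i := hi
  refine ⟨fun {a b} sq => ?_⟩
  obtain ⟨F, hF₀, hF₁, hF₂⟩ := exists_homotopy_extension i p 1 (a ▷ Δ[1] ≫ L) (b ≫ s)
    (fst D Δ[1] ≫ b) (by rw [← ept_naturality_assoc, hL₁, sq.w_assoc])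
    (by simp [hL, sq.w]) (by simp [hs, ept_fst_assoc])
  exact ⟨⟨⟨ept D 0 ≫ F, by rw [ept_naturality_assoc, hF₀, ← ept_naturality_assoc, hL₀,
    Category.comp_id], by rw [Category.assoc, hF₂, ept_fst_assoc]⟩⟩⟩

lemma HomotopyEquivalence.of_rlp_monomorphisms {E B : SSet.{0}} (p : E ⟶ B)
    (hp : (MorphismProperty.monomorphisms SSet.{0}).rlp p) : HomotopyEquivalence p := by
  obtain ⟨s, hs⟩ : ∃ s : B ⟶ E, s ≫ p = 𝟙 B := by
    have sq : CommSq (initial.to E) (initial.to B) p (𝟙 B) := ⟨initialIsInitial.hom_ext _ _⟩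
    have := hp (initial.to B) inferInstance
    exact ⟨sq.lift, sq.fac_right⟩
  refine ⟨s, .of_homotopy ?_, .of_eq hs⟩
  let i : (FunctorToTypes.coprod E E : SSet.{0}) ⟶ E ⊗ Δ[1] :=
    FunctorToTypes.coprod.desc (ept E 0) (ept E 1)
  have hi : Mono i := by
    rw [NatTrans.mono_iff_mono_app]
    intro n
    rw [mono_iff_injective]
    have h01 : SSet.stdSimplex.const 1 0 n ≠ SSet.stdSimplex.const 1 1 n := fun h => by
      have := congrArg (fun t => (stdSimplex.objEquiv t).toOrderHom 0) h
      exact absurd this (by decide : (0 : Fin 2) ≠ 1)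
    rintro (x | x) (y | y) hxy
    · exact congrArg Sum.inl (congrArg Prod.fst hxy)
    · exact absurd (congrArg Prod.snd hxy) h01
    · exact absurd (congrArg Prod.snd hxy).symm h01
    · exact congrArg Sum.inr (congrArg Prod.fst hxy)
  have h_sect : (p ≫ s) ≫ p = ept E 0 ≫ fst E Δ[1] ≫ p := by
    simp [hs, ept_fst_assoc]
  have sq : CommSq (FunctorToTypes.coprod.desc (p ≫ s) (𝟙 E)) i p (fst E Δ[1] ≫ p) := ⟨by
    ext n (x | x)
    · exact ConcreteCategory.congr_hom (NatTrans.congr_app h_sect n) x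
    · rfl⟩
  have := hp i hi
  exact ⟨sq.lift, FunctorToTypes.coprod.inl ≫= sq.fac_left,
    FunctorToTypes.coprod.inr ≫= sq.fac_left⟩

end Homotopies

section Acyclic

open CartesianMonoidalCategory MonoidalClosed

lemma WeakHomotopyEquivalence.comp {X Y Z : SSet.{0}} {f : X ⟶ Y} {g : Y ⟶ Z}
    (hf : WeakHomotopyEquivalence f) (hg : WeakHomotopyEquivalence g) :
    WeakHomotopyEquivalence (f ≫ g) := fun K hK => by
  rw [MonoidalClosed.pre_map]
  exact (hg K hK).comp (hf K hK)

lemma WeakHomotopyEquivalence.of_comp_left {X Y Z : SSet.{0}} {f : X ⟶ Y} {g : Y ⟶ Z}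
    (hg : WeakHomotopyEquivalence g) (hfg : WeakHomotopyEquivalence (f ≫ g)) :
    WeakHomotopyEquivalence f := fun K hK => by
  have := hfg K hK
  rw [MonoidalClosed.pre_map] at this
  exact (hg K hK).of_comp_right this

lemma WeakHomotopyEquivalence.of_comp_right {X Y Z : SSet.{0}} {f : X ⟶ Y} {g : Y ⟶ Z}
    (hf : WeakHomotopyEquivalence f) (hfg : WeakHomotopyEquivalence (f ≫ g)) :
    WeakHomotopyEquivalence g := fun K hK => by
  have := hfg K hK
  rw [MonoidalClosed.pre_map] at this
  exact (hf K hK).of_comp_left this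

/-- Fibrations between Kan complexes. -/
def kanFibrations : MorphismProperty SSet.{0} :=
  fun E B p => Fibration p ∧ SSet.KanComplex E ∧ SSet.KanComplex B

/-- Morphisms with the left lifting property with respect to all fibrations
between Kan complexes. -/
def acyclic : MorphismProperty SSet.{0} := kanFibrations.llp

instance : acyclic.IsMultiplicative := inferInstanceAs kanFibrations.llp.IsMultiplicative

instance : acyclic.IsStableUnderCobaseChange :=
  inferInstanceAs kanFibrations.llp.IsStableUnderCobaseChange

instance : acyclic.RespectsIso := inferInstanceAs kanFibrations.llp.RespectsIso

lemma acyclic_of_isIso {X Y : SSet.{0}} (f : X ⟶ Y) [IsIso f] : acyclic f :=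
  MorphismProperty.llp_of_isIso _ f

lemma acyclic_of_anodyne {X Y : SSet.{0}} {f : X ⟶ Y} (hf : anodyneExtensions f) :
    acyclic f := fun _ _ p hp => hf p (by
  rw [← HomotopicalAlgebra.fibration_iff]; exact hp.1)

lemma kanFibrations_pullbackObjObj {A C E B : SSet.{0}} {i : A ⟶ C} [Mono i] {p : E ⟶ B}
    (hp : kanFibrations p) (sq : MonoidalClosed.internalHom.PullbackObjObj i p) :
    kanFibrations sq.π := by
  obtain ⟨h₁, h₂, h₃⟩ := hp
  have h₄ : Fibration ((MonoidalClosed.internalHom.map i.op).app B) :=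
    inferInstanceAs (Fibration ((MonoidalClosed.pre i).app B))
  have h₅ : Fibration sq.fst := by
    rw [SSet.modelCategoryQuillen.fibration_iff] at h₄ ⊢
    exact MorphismProperty.of_isPullback sq.isPullback.flip h₄
  have h₆ : SSet.KanComplex ((MonoidalClosed.internalHom.obj (.op A)).obj E) :=
    inferInstanceAs (SSet.KanComplex ((ihom A).obj E))
  exact ⟨fibration_pullbackObjObjπ sq, inferInstanceAs (SSet.KanComplex ((ihom C).obj E)),
    isFibrant_of_fibration sq.fst⟩

/-- The pushout-product of an acyclic map with a monomorphism is acyclic. -/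
lemma acyclic_pushoutObjObj {A C X Y : SSet.{0}} {i : A ⟶ C} {j : X ⟶ Y} [Mono j]
    (hi : acyclic i) (sq : (curriedTensor SSet.{0}).PushoutObjObj i j) : acyclic sq.ι := by
  intro E B p hp
  rw [HasLiftingProperty.iff_of_arrow_iso_left
    (show Arrow.mk sq.ι ≅ Arrow.mk sq.flipTensor.ι from
      Arrow.isoMk (Iso.refl _) (β_ _ _))]
  let sq' := Functor.PullbackObjObj.ofHasPullback MonoidalClosed.internalHom j p
  rw [internalHomAdjunction₂.hasLiftingProperty_iff _ sq']
  exact hi _ (kanFibrations_pullbackObjObj hp sq')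

lemma acyclic.weakHomotopyEquivalence {A C : SSet.{0}} {i : A ⟶ C} [Mono i]
    (hi : acyclic i) : WeakHomotopyEquivalence i := by
  intro K hK
  rw [kanComplex_iff] at hK
  apply HomotopyEquivalence.of_rlp_monomorphisms
  intro X Y j (hj : Mono j)
  let sq := Functor.PushoutObjObj.ofHasPushout (curriedTensor SSet.{0}) i j
  let sq' := Functor.PullbackObjObj.ofIsTerminal MonoidalClosed.internalHom i
    (terminal.from K) terminalIsTerminal
  have : HasLiftingProperty j sq'.π := by
    rw [← internalHomAdjunction₂.hasLiftingProperty_iff sq]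
    refine acyclic_pushoutObjObj hi sq _ ⟨(isFibrant_iff K).1 hK, hK, ?_⟩
    refine (isFibrant_iff _).2 ?_
    rw [SSet.modelCategoryQuillen.fibration_iff,
      terminal.hom_ext (terminal.from (⊤_ SSet.{0})) (𝟙 _)]
    exact MorphismProperty.rlp_of_isIso _ _
  exact this

lemma WeakHomotopyEquivalence.acyclic {A C : SSet.{0}} {i : A ⟶ C} [Mono i]
    (hi : WeakHomotopyEquivalence i) : acyclic i := by
  intro E B p hp
  have hp' := hp
  obtain ⟨h₁, h₂, h₃⟩ := hp'
  let sq := Functor.PullbackObjObj.ofHasPullback MonoidalClosed.internalHom i p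
  obtain ⟨h₄, h₅, h₆⟩ := kanFibrations_pullbackObjObj hp sq
  have h₇ : (MorphismProperty.monomorphisms SSet.{0}).rlp
      ((MonoidalClosed.internalHom.map i.op).app B) :=
    HomotopyEquivalence.rlp_monomorphisms ((MonoidalClosed.pre i).app B)
      (hi B ((kanComplex_iff B).2 h₃))
  have h₈ : HomotopyEquivalence sq.fst :=
    .of_rlp_monomorphisms _ (MorphismProperty.of_isPullback sq.isPullback.flip h₇)
  have h₉ : HomotopyEquivalence sq.π := by
    refine h₈.of_comp_left ?_
    rw [sq.π_fst]
    exact hi E ((kanComplex_iff E).2 h₂)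
  have h₁₀ := h₉.rlp_monomorphisms sq.π (initial.to (𝟙_ SSet.{0})) inferInstance
  rw [← internalHomAdjunction₂.hasLiftingProperty_iff
    (.ofIsInitialRight (curriedTensor SSet.{0}) i (initial.to (𝟙_ SSet.{0})) initialIsInitial)]
    at h₁₀
  rw [HasLiftingProperty.iff_of_arrow_iso_left
    (show Arrow.mk i ≅ Arrow.mk (i ▷ 𝟙_ SSet.{0}) from
      Arrow.isoMk (ρ_ _).symm (ρ_ _).symm)]
  exact h₁₀

lemma acyclic_of_comp {A B C : SSet.{0}} (f : A ⟶ B) (g : B ⟶ C) [Mono f] [Mono g]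
    (hf : acyclic f) (hfg : acyclic (f ≫ g)) : acyclic g :=
  (hf.weakHomotopyEquivalence.of_comp_right hfg.weakHomotopyEquivalence).acyclic

/-- The inclusion of a strong deformation retract is anodyne. -/
lemma anodyne_of_deformationRetract {B E : SSet.{0}} (s : B ⟶ E) (r : E ⟶ B)
    (hsr : s ≫ r = 𝟙 B) (e e' : Fin 2) (H : E ⊗ Δ[1] ⟶ E) (h₀ : ept E e ≫ H = r ≫ s)
    (h₁ : ept E e' ≫ H = 𝟙 E) (h₂ : s ▷ Δ[1] ≫ H = fst B Δ[1] ≫ s) :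
    anodyneExtensions s := by
  intro E' B' p hp
  rw [← HomotopicalAlgebra.fibration_iff] at hp
  have : IsSplitMono s := ⟨⟨⟨r, hsr⟩⟩⟩
  refine ⟨fun {a b} sq => ?_⟩
  obtain ⟨F, hF₀, hF₁, hF₂⟩ := exists_homotopy_extension s p e (fst B Δ[1] ≫ a) (r ≫ a)
    (H ≫ b) (by simp [reassoc_of% hsr, ept_fst_assoc]) (by simp [reassoc_of% h₂, sq.w])
    (by simp [reassoc_of% h₀, sq.w])
  exact ⟨⟨⟨ept E e' ≫ F, by rw [ept_naturality_assoc, hF₀, ept_fst_assoc],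
    by rw [Category.assoc, hF₂, reassoc_of% h₁]⟩⟩⟩

lemma WeakHomotopyEquivalence.of_deformationRetract {B E : SSet.{0}} (s : B ⟶ E) (r : E ⟶ B)
    (hsr : s ≫ r = 𝟙 B) (e e' : Fin 2) (H : E ⊗ Δ[1] ⟶ E) (h₀ : ept E e ≫ H = r ≫ s)
    (h₁ : ept E e' ≫ H = 𝟙 E) (h₂ : s ▷ Δ[1] ≫ H = fst B Δ[1] ≫ s) :
    WeakHomotopyEquivalence r := by
  have : IsSplitMono s := ⟨⟨⟨r, hsr⟩⟩⟩
  have hs : WeakHomotopyEquivalence s :=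
    (acyclic_of_anodyne (anodyne_of_deformationRetract s r hsr e e' H h₀ h₁ h₂)
      ).weakHomotopyEquivalence
  refine hs.of_comp_right ?_
  rw [hsr]
  exact (acyclic_of_isIso _).weakHomotopyEquivalence

end Acyclic

section Subcomplexes

/-- The inclusion `A ≤ B` of subcomplexes is acyclic. -/
def AcyclicLE {X : SSet.{0}} (A B : X.Subcomplex) : Prop :=
  ∃ h : A ≤ B, acyclic (Subcomplex.homOfLE h)

lemma AcyclicLE.refl {X : SSet.{0}} (A : X.Subcomplex) : AcyclicLE A A :=
  ⟨le_rfl, acyclic_of_isIso (𝟙 _)⟩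

lemma AcyclicLE.trans {X : SSet.{0}} {A B C : X.Subcomplex} (h₁ : AcyclicLE A B)
    (h₂ : AcyclicLE B C) : AcyclicLE A C := by
  obtain ⟨h₁, h₁'⟩ := h₁
  obtain ⟨h₂, h₂'⟩ := h₂
  exact ⟨h₁.trans h₂, acyclic.comp_mem _ _ h₁' h₂'⟩

lemma AcyclicLE.of_le {X : SSet.{0}} {A B C : X.Subcomplex} (h₁ : AcyclicLE A B)
    (h₂ : AcyclicLE A C) (h : B ≤ C) : AcyclicLE B C := by
  obtain ⟨h₁, h₁'⟩ := h₁
  obtain ⟨h₂, h₂'⟩ := h₂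
  exact ⟨h, acyclic_of_comp (Subcomplex.homOfLE h₁) (Subcomplex.homOfLE h) h₁' h₂'⟩

lemma AcyclicLE.sup {X : SSet.{0}} {A B : X.Subcomplex} (h : AcyclicLE (A ⊓ B) B) :
    AcyclicLE A (A ⊔ B) := by
  obtain ⟨_, h'⟩ := h
  have sq : Subcomplex.BicartSq (A ⊓ B) A B (A ⊔ B) := ⟨rfl, rfl⟩
  exact ⟨le_sup_left, MorphismProperty.of_isPushout (P := acyclic) sq.isPushout h'⟩

lemma AcyclicLE.image {X Y : SSet.{0}} {A B : X.Subcomplex} (h : AcyclicLE A B) (f : X ⟶ Y)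
    [Mono f] : AcyclicLE (A.image f) (B.image f) := by
  obtain ⟨h, h'⟩ := h
  refine ⟨Subcomplex.image_monotone f h, ?_⟩
  have hm (A : X.Subcomplex) : IsIso (A.toImage f) := by
    have : Mono (A.toImage f) := mono_of_mono_fac (A.toImage_ι f)
    exact isIso_of_mono_of_epi _
  exact (acyclic.arrow_mk_iso_iff (show Arrow.mk (Subcomplex.homOfLE h) ≅ Arrow.mk _ from
    Arrow.isoMk (@asIso _ _ _ _ _ (hm A)) (@asIso _ _ _ _ _ (hm B)) rfl)).1 h'

lemma acyclicLE_top_iff {X : SSet.{0}} (A : X.Subcomplex) : AcyclicLE A ⊤ ↔ acyclic A.ι := by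
  have e : Arrow.mk (Subcomplex.homOfLE (le_top : A ≤ ⊤)) ≅ Arrow.mk A.ι :=
    Arrow.isoMk (Iso.refl _) (Subcomplex.topIso X) rfl
  exact ⟨fun ⟨_, h⟩ => (acyclic.arrow_mk_iso_iff e).1 h,
    fun h => ⟨le_top, (acyclic.arrow_mk_iso_iff e).2 h⟩⟩

lemma AcyclicLE.sup_sup {X : SSet.{0}} {A₁ B₁ A₂ B₂ : X.Subcomplex} (h₁ : AcyclicLE A₁ B₁)
    (h₂ : AcyclicLE A₂ B₂) (h₁₂ : AcyclicLE (A₁ ⊓ A₂) (B₁ ⊓ B₂)) (h : A₂ ⊓ B₁ ≤ A₁) :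
    AcyclicLE (A₁ ⊔ A₂) (B₁ ⊔ B₂) := by
  have l₁ : A₁ ≤ B₁ := h₁.1
  have l₂ : A₂ ≤ B₂ := h₂.1
  have m₁ (n) (x) (hx : x ∈ A₁.obj n) : x ∈ B₁.obj n := l₁ n hx
  have m₂ (n) (x) (hx : x ∈ A₂.obj n) : x ∈ B₂.obj n := l₂ n hx
  have m (n) (x) (hx : x ∈ A₂.obj n) (hx' : x ∈ B₁.obj n) : x ∈ A₁.obj n := h n ⟨hx, hx'⟩
  have e₁ : (A₁ ⊔ A₂) ⊓ B₁ = A₁ := by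
    ext n x
    change ((x ∈ A₁.obj n ∨ x ∈ A₂.obj n) ∧ x ∈ B₁.obj n) ↔ _
    have := m₁ n x
    have := m n x
    tauto
  have e₂ : (A₁ ⊔ A₂) ⊔ B₁ = B₁ ⊔ A₂ := by
    rw [sup_right_comm, sup_eq_right.2 l₁]
  have e₃ : A₂ ⊓ (B₁ ⊓ B₂) = A₁ ⊓ A₂ := by
    ext n x
    change (x ∈ A₂.obj n ∧ x ∈ B₁.obj n ∧ x ∈ B₂.obj n) ↔ (x ∈ A₁.obj n ∧ x ∈ A₂.obj n)
    have := m₁ n x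
    have := m₂ n x
    have := m n x
    tauto
  have e₄ : (B₁ ⊔ A₂) ⊓ B₂ = A₂ ⊔ (B₁ ⊓ B₂) := by
    ext n x
    change ((x ∈ B₁.obj n ∨ x ∈ A₂.obj n) ∧ x ∈ B₂.obj n) ↔
      (x ∈ A₂.obj n ∨ x ∈ B₁.obj n ∧ x ∈ B₂.obj n)
    have := m₂ n x
    tauto
  have e₅ : (B₁ ⊔ A₂) ⊔ B₂ = B₁ ⊔ B₂ := by
    rw [sup_assoc, sup_eq_right.2 l₂]
  have a₁ : AcyclicLE (A₁ ⊔ A₂) (B₁ ⊔ A₂) := by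
    rw [← e₂]
    apply AcyclicLE.sup
    rwa [e₁]
  have a₂ : AcyclicLE A₂ ((B₁ ⊔ A₂) ⊓ B₂) := by
    rw [e₄]
    apply AcyclicLE.sup
    rwa [e₃]
  have a₃ : AcyclicLE (B₁ ⊔ A₂) (B₁ ⊔ B₂) := by
    rw [← e₅]
    exact (a₂.of_le h₂ inf_le_right).sup
  exact a₁.trans a₃

end Subcomplexes

section Latching

variable (Z : SimplicialObject SSet.{0})

/-- The simplicial set of simplices of a given internal degree of a bisimplicial set. -/
abbrev row (d : SimplexCategoryᵒᵖ) : SSet.{0} := Z ⋙ (evaluation _ _).obj d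

variable {Z}

/-- A family of subcomplexes of the columns which is stable under the simplicial operators. -/
def IsStableFamily (S : ∀ n, (Z.obj n).Subcomplex) : Prop :=
  ∀ ⦃n m : SimplexCategoryᵒᵖ⦄ (φ : n ⟶ m) (d : SimplexCategoryᵒᵖ) (x : (Z.obj n).obj d),
    x ∈ (S n).obj d → (Z.map φ).app d x ∈ (S m).obj d

/-- The subcomplex of `Z _⦋n⦌` of simplices of the form `σ i y` with `i < k` and `y ∈ S`. -/
def degenerateSubcomplex (S : ∀ n, (Z.obj n).Subcomplex) : ∀ n : ℕ, ℕ → (Z _⦋n⦌).Subcomplex :=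
  fun n k => match n with
  | 0 => ⊥
  | n + 1 => ⨆ (i : Fin (n + 1)) (_ : i.1 < k), (S (.op ⦋n⦌)).image (Z.σ i)

variable (S : ∀ n, (Z.obj n).Subcomplex)

lemma mem_degenerateSubcomplex_iff (n k : ℕ) (d : SimplexCategoryᵒᵖ)
    (x : (Z _⦋n + 1⦌).obj d) :
    x ∈ (degenerateSubcomplex S (n + 1) k).obj d ↔ ∃ (i : Fin (n + 1)) (_ : i.1 < k)
      (y : (row Z d) _⦋n⦌) (_ : y ∈ (S (.op ⦋n⦌)).obj d), (row Z d).σ i y = x := by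
  simp [degenerateSubcomplex]
  rfl

lemma degenerateSubcomplex_zero (n : ℕ) : degenerateSubcomplex S n 0 = ⊥ := by
  cases n <;> simp [degenerateSubcomplex]

lemma degenerateSubcomplex_succ {n k : ℕ} (hk : k < n + 1) :
    degenerateSubcomplex S (n + 1) (k + 1) = degenerateSubcomplex S (n + 1) k ⊔
      (S (.op ⦋n⦌)).image (Z.σ (⟨k, hk⟩ : Fin (n + 1))) := by
  ext d x
  change x ∈ _ ↔ x ∈ _ ∨ x ∈ _
  rw [mem_degenerateSubcomplex_iff, mem_degenerateSubcomplex_iff]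
  constructor
  · rintro ⟨i, hi, y, hy, rfl⟩
    obtain hi | hi := Nat.lt_succ_iff_lt_or_eq.1 hi
    · exact Or.inl ⟨i, hi, y, hy, rfl⟩
    · obtain rfl : i = ⟨k, hk⟩ := Fin.ext hi
      exact Or.inr ⟨y, hy, rfl⟩
  · rintro (⟨i, hi, y, hy, rfl⟩ | ⟨y, hy, rfl⟩)
    · exact ⟨i, by lia, y, hy, rfl⟩
    · exact ⟨⟨k, hk⟩, by simp, y, hy, rfl⟩

lemma degenerateSubcomplex_succ_of_le {n k : ℕ} (hk : n + 1 ≤ k) :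
    degenerateSubcomplex S (n + 1) (k + 1) = degenerateSubcomplex S (n + 1) k := by
  ext d x
  rw [mem_degenerateSubcomplex_iff, mem_degenerateSubcomplex_iff]
  constructor
  all_goals
    rintro ⟨i, hi, y, hy, rfl⟩
    exact ⟨i, by lia, y, hy, rfl⟩

variable {S} (hS : IsStableFamily S)

include hS

lemma IsStableFamily.δ {d : SimplexCategoryᵒᵖ} {n : ℕ} (i : Fin (n + 2)) {x : (row Z d) _⦋n + 1⦌}
    (hx : x ∈ (S (.op ⦋n + 1⦌)).obj d) : (row Z d).δ i x ∈ (S (.op ⦋n⦌)).obj d :=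
  hS _ _ _ hx

lemma IsStableFamily.σ {d : SimplexCategoryᵒᵖ} {n : ℕ} (i : Fin (n + 1)) {x : (row Z d) _⦋n⦌}
    (hx : x ∈ (S (.op ⦋n⦌)).obj d) : (row Z d).σ i x ∈ (S (.op ⦋n + 1⦌)).obj d :=
  hS _ _ _ hx

lemma degenerateSubcomplex_inf_image {n k : ℕ} (hk : k < n + 1) :
    degenerateSubcomplex S (n + 1) k ⊓ (S (.op ⦋n⦌)).image (Z.σ (⟨k, hk⟩ : Fin (n + 1))) =
      (degenerateSubcomplex S n k).image (Z.σ (⟨k, hk⟩ : Fin (n + 1))) := by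
  obtain _ | n := n
  · obtain rfl : k = 0 := by lia
    rw [degenerateSubcomplex_zero, degenerateSubcomplex_zero, bot_inf_eq, eq_comm, eq_bot_iff]
    rintro d _ ⟨_, h, rfl⟩
    exact h
  ext d x
  constructor
  · rintro ⟨h₁, ⟨z, hz, rfl⟩⟩
    obtain ⟨i, hi, y, hy, hyz⟩ := (mem_degenerateSubcomplex_iff S _ _ _ _).1 h₁
    change (row Z d).σ i y = (row Z d).σ ⟨k, hk⟩ z at hyz
    refine ⟨z, (mem_degenerateSubcomplex_iff S _ _ _ _).2
      ⟨⟨i, by lia⟩, hi, (row Z d).δ ⟨k, by lia⟩ y, hS.δ _ hy, ?_⟩, rfl⟩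
    have h₂ := congrArg ((row Z d).δ (⟨k, hk⟩ : Fin (n + 2)).succ) hyz
    rw [SSet.δ_comp_σ_succ_apply] at h₂
    rw [← h₂]
    exact (SSet.δ_comp_σ_of_gt_apply (S := row Z d) (i := ⟨k, by lia⟩) (j := ⟨i, by lia⟩) hi y).symm
  · rintro ⟨z, hz, rfl⟩
    obtain ⟨i, hi, y, hy, rfl⟩ := (mem_degenerateSubcomplex_iff S _ _ _ _).1 hz
    refine ⟨(mem_degenerateSubcomplex_iff S _ _ _ _).2 ⟨i.castSucc, hi,
      (row Z d).σ ⟨k - 1, by lia⟩ y, hS.σ _ hy, ?_⟩, ⟨_, hS.σ _ hy, rfl⟩⟩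
    have h := SSet.σ_comp_σ_apply (S := row Z d) (i := i) (j := ⟨k - 1, by lia⟩)
      (Fin.mk_le_mk.2 (by lia)) y
    have e : (⟨k - 1, by lia⟩ : Fin (n + 1)).succ = ⟨k, hk⟩ := Fin.ext (by simp; lia)
    rw [e] at h
    exact h

lemma mem_degenerateSubcomplex_of_mem_top {n k : ℕ} {d : SimplexCategoryᵒᵖ}
    {x : (Z _⦋n⦌).obj d} (hx : x ∈ (S (.op ⦋n⦌)).obj d)
    (hx' : x ∈ (degenerateSubcomplex (fun n => (⊤ : (Z.obj n).Subcomplex)) n k).obj d) :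
    x ∈ (degenerateSubcomplex S n k).obj d := by
  obtain _ | n := n
  · exact hx'
  obtain ⟨i, hi, y, -, rfl⟩ := (mem_degenerateSubcomplex_iff _ _ _ _ _).1 hx'
  refine (mem_degenerateSubcomplex_iff _ _ _ _ _).2 ⟨i, hi, y, ?_, rfl⟩
  have := hS.δ i.castSucc hx
  rwa [SSet.δ_comp_σ_self_apply] at this

lemma degenerateSubcomplex_le (n k : ℕ) : degenerateSubcomplex S n k ≤ S (.op ⦋n⦌) := by
  obtain _ | n := n
  · exact bot_le
  intro d x hx
  obtain ⟨i, hi, y, hy, rfl⟩ := (mem_degenerateSubcomplex_iff _ _ _ _ _).1 hx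
  exact hS.σ _ hy

lemma acyclicLE_degenerateSubcomplex (h : ∀ n, AcyclicLE (S n) ⊤) (n k : ℕ) :
    AcyclicLE (degenerateSubcomplex S n k)
      (degenerateSubcomplex (fun n => (⊤ : (Z.obj n).Subcomplex)) n k) := by
  induction k generalizing n with
  | zero =>
    rw [degenerateSubcomplex_zero, degenerateSubcomplex_zero]
    exact .refl _
  | succ k hk =>
    obtain _ | n := n
    · exact .refl _
    by_cases hkn : k < n + 1
    · rw [degenerateSubcomplex_succ S hkn, degenerateSubcomplex_succ _ hkn]
      have : Mono (Z.σ (⟨k, hkn⟩ : Fin (n + 1))) :=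
        mono_of_mono_fac (SimplicialObject.δ_comp_σ_self Z (i := ⟨k, hkn⟩))
      refine (hk (n + 1)).sup_sup ((h _).image _) ?_ ?_
      · rw [degenerateSubcomplex_inf_image hS, degenerateSubcomplex_inf_image
          (S := fun n => (⊤ : (Z.obj n).Subcomplex)) (fun _ _ _ _ _ _ => trivial)]
        exact (hk n).image _
      · rintro d _ ⟨⟨y, hy, rfl⟩, hx⟩
        exact mem_degenerateSubcomplex_of_mem_top hS (hS.σ ⟨k, hkn⟩ hy) hx
    · rw [degenerateSubcomplex_succ_of_le _ (by lia), degenerateSubcomplex_succ_of_le _ (by lia)]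
      exact hk _

omit hS

variable (S) in
/-- The union of `S` and the degenerate simplices of `Z _⦋n⦌`. -/
def latching (n : ℕ) : (Z _⦋n⦌).Subcomplex :=
  S (.op ⦋n⦌) ⊔ degenerateSubcomplex (fun n => (⊤ : (Z.obj n).Subcomplex)) n n

variable (S) in
lemma mem_latching_iff (n : ℕ) (d : SimplexCategoryᵒᵖ) (x : (Z _⦋n⦌).obj d) :
    x ∈ (latching S n).obj d ↔ x ∈ (S (.op ⦋n⦌)).obj d ∨ x ∈ (row Z d).degenerate n := by
  change x ∈ _ ∨ x ∈ _ ↔ _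
  apply or_congr_right
  obtain _ | n := n
  · rw [SSet.degenerate_zero]
    rfl
  · rw [mem_degenerateSubcomplex_iff, SSet.degenerate_eq_iUnion_range_σ, Set.mem_iUnion]
    exact exists_congr fun i => ⟨fun ⟨_, y, _, h⟩ => ⟨y, h⟩, fun ⟨y, h⟩ => ⟨i.2, y, trivial, h⟩⟩

lemma acyclic_latching_ι (hS : IsStableFamily S) (h : ∀ n, AcyclicLE (S n) ⊤) (n : ℕ) :
    acyclic (latching S n).ι := by
  rw [← acyclicLE_top_iff]
  refine AcyclicLE.of_le (A := S (.op ⦋n⦌)) ?_ (h _) le_top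
  apply AcyclicLE.sup
  have e : S (.op ⦋n⦌) ⊓ degenerateSubcomplex (fun n => (⊤ : (Z.obj n).Subcomplex)) n n =
      degenerateSubcomplex S n n := by
    ext d x
    have := acyclicLE_degenerateSubcomplex hS h n n
    exact ⟨fun ⟨h₁, h₂⟩ => mem_degenerateSubcomplex_of_mem_top hS h₁ h₂,
      fun h => ⟨degenerateSubcomplex_le hS _ _ _ h, this.1 _ h⟩⟩
  rw [e]
  exact acyclicLE_degenerateSubcomplex hS h n n

end Latching

section Filtration

/-- Attaching along a map which is injective outside the preimage of a subcomplex. -/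
lemma AcyclicLE.of_attach {W Y : SSet.{0}} (f : W ⟶ Y) (A : Y.Subcomplex)
    (h : acyclic (A.preimage f).ι)
    (hf : ∀ (d : SimplexCategoryᵒᵖ) (x y : W.obj d), x ∉ (A.preimage f).obj d →
      y ∉ (A.preimage f).obj d → f.app d x = f.app d y → x = y) :
    AcyclicLE A (A ⊔ Subcomplex.range f) := by
  have hA : A ≤ A ⊔ Subcomplex.range f := le_sup_left
  have hB : Subcomplex.range f ≤ A ⊔ Subcomplex.range f := le_sup_right
  have w : A.fromPreimage f ≫ Subcomplex.homOfLE hA =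
    (A.preimage f).ι ≫ Subcomplex.lift f hB := rfl
  refine ⟨hA, MorphismProperty.of_isPushout (P := acyclic) (g := A.fromPreimage f)
    (g' := Subcomplex.lift f hB) ⟨⟨w⟩, ⟨evaluationJointlyReflectsColimits _ fun d => ?_⟩⟩ h⟩
  refine (isColimitMapCoconePushoutCoconeEquiv _ _).2 (IsPushout.isColimit ?_)
  refine Types.isPushout_of_isPullback_of_mono' ?_ ?_ ?_
  · rw [Types.isPullback_iff]
    refine ⟨NatTrans.congr_app w d, fun x y h => Subtype.ext h.2, fun x y h => ?_⟩
    have h' : x.1 = f.app d y := congrArg Subtype.val h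
    refine ⟨⟨y, ?_⟩, Subtype.ext h'.symm, rfl⟩
    change f.app d y ∈ A.obj d
    rw [← h']
    exact x.2
  · rw [Set.eq_univ_iff_forall]
    rintro ⟨x, hx | ⟨y, rfl⟩⟩
    · exact Or.inl ⟨⟨x, hx⟩, rfl⟩
    · exact Or.inr ⟨y, rfl⟩
  · intro x y hx hy hxy
    exact hf d x y (fun h => hx ⟨⟨x, h⟩, rfl⟩) (fun h => hy ⟨⟨y, h⟩, rfl⟩)
      (congrArg Subtype.val hxy)

/-- The inclusion of the first term in an exhaustive filtration is acyclic if all of the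
steps of the filtration are. -/
lemma acyclic_of_filtration {Y : SSet.{0}} (F : ℕ → Y.Subcomplex)
    (hF : ∀ n, AcyclicLE (F n) (F (n + 1))) (hF' : ⨆ n, F n = ⊤) : acyclic (F 0).ι := by
  have hm : Monotone F := monotone_nat_of_le_succ fun n => (hF n).1
  let G : ℕ ⥤ SSet.{0} := hm.functor ⋙ Subcomplex.toSSetFunctor
  let c : Cocone G :=
    { pt := Y
      ι := { app n := (F n).ι } }
  let hc : IsColimit c := IsColimit.ofIsoColimit (isColimitOfPreserves Subcomplex.toSSetFunctor
      (CompleteLattice.colimitCocone hm.functor).isColimit)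
        (Cocone.ext (Subcomplex.eqToIso hF' ≪≫ Subcomplex.topIso Y))
  have h : acyclic.transfiniteCompositionsOfShape ℕ (F 0).ι :=
    ⟨{ F := G
       isoBot := Iso.refl _
       incl := c.ι
       isColimit := hc
       map_mem n _ := (hF n).2 }⟩
  have : acyclic.IsStableUnderTransfiniteCompositionOfShape ℕ :=
    inferInstanceAs (kanFibrations.llp.IsStableUnderTransfiniteCompositionOfShape ℕ)
  exact MorphismProperty.transfiniteCompositionsOfShape_le _ ℕ _ h

variable {Z : SimplicialObject SSet.{0}}

lemma mem_skeleton_iff {X : SSet.{0}} {n : ℕ} {d : SimplexCategoryᵒᵖ} (x : X.obj d) :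
    x ∈ (X.skeleton n).obj d ↔
      ∃ (m : ℕ) (_ : m < n) (θ : .op ⦋m⦌ ⟶ d) (z : X _⦋m⦌), X.map θ z = x := by
  constructor
  · intro h
    rw [show X.skeleton n = ⨆ (i : Fin n) (x : X.nonDegenerate i), Subcomplex.ofSimplex x.1
      from rfl] at h
    simp only [Subfunctor.iSup_obj, Set.mem_iUnion] at h
    obtain ⟨m, z, ⟨θ, h⟩⟩ := h
    exact ⟨m, m.2, θ, z, h⟩
  · rintro ⟨m, hm, θ, z, rfl⟩
    exact (X.skeleton n).map θ (mem_skeleton X z hm)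

/-- Restriction along an operator of the internal degree. -/
def rowMap (Z : SimplicialObject SSet.{0}) {d d' : SimplexCategoryᵒᵖ} (φ : d ⟶ d') :
    row Z d ⟶ row Z d' where
  app n := (Z.obj n).map φ
  naturality _ _ θ := ((Z.map θ).naturality φ).symm

variable {Z : SimplicialObject SSet.{0}}

lemma diag_map_apply {d d' : SimplexCategoryᵒᵖ} (φ : d ⟶ d') (x : (row Z d).obj d) :
    (diag Z).map φ x = (row Z d').map φ ((rowMap Z φ).app d x) := rfl

/-- The map `(z, θ) ↦ Z.map θ z`. -/
def attach (Z : SimplicialObject SSet.{0}) (n : ℕ) : (Z _⦋n⦌) ⊗ Δ[n] ⟶ diag Z where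
  app d := ↾fun x => (row Z d).map (stdSimplex.objEquiv x.2).op x.1
  naturality d d' φ := by
    refine ConcreteCategory.hom_ext _ _ fun x => ?_
    change (row Z d').map (stdSimplex.objEquiv ((Δ[n] : SSet.{0}).map φ x.2)).op
      ((rowMap Z φ).app _ x.1) = (row Z d').map φ ((rowMap Z φ).app d
        ((row Z d).map (stdSimplex.objEquiv x.2).op x.1))
    rw [NatTrans.naturality_apply, ← Functor.map_comp_apply]
    rfl

lemma attach_app_apply {n : ℕ} {d : SimplexCategoryᵒᵖ} (z : (Z _⦋n⦌).obj d)
    (θ : d.unop ⟶ ⦋n⦌) :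
    (attach Z n).app d (z, stdSimplex.objEquiv.symm θ) = (row Z d).map θ.op z :=
  congrArg (fun θ : d.unop ⟶ ⦋n⦌ => (row Z d).map θ.op z)
    (Equiv.apply_symm_apply stdSimplex.objEquiv.{0} θ)

/-- The union of `S` with the simplices of the diagonal of external dimension `< n`. -/
def diagSkeleton {S : ∀ n, (Z.obj n).Subcomplex} (hS : IsStableFamily S) (n : ℕ) :
    (diag Z).Subcomplex where
  obj d := {x | x ∈ (S d).obj d ∨ x ∈ ((row Z d).skeleton n).obj d}
  map {d d'} φ := by
    rintro x (hx | hx)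
    · exact Or.inl (hS φ _ _ ((S d).map φ hx))
    · obtain ⟨m, hm, θ, z, rfl⟩ := (mem_skeleton_iff _).1 hx
      refine Or.inr ((mem_skeleton_iff (X := row Z d') _).2
        ⟨m, hm, θ ≫ φ, (rowMap Z φ).app _ z, ?_⟩)
      rw [diag_map_apply, NatTrans.naturality_apply, ← Functor.map_comp_apply]

variable {S : ∀ n, (Z.obj n).Subcomplex} (hS : IsStableFamily S)

lemma mem_diagSkeleton_iff {n : ℕ} {d : SimplexCategoryᵒᵖ} (x : (row Z d).obj d) :
    x ∈ (diagSkeleton hS n).obj d ↔ x ∈ (S d).obj d ∨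
      ∃ (m : ℕ) (_ : m < n) (θ : .op ⦋m⦌ ⟶ d) (z : (row Z d) _⦋m⦌), (row Z d).map θ z = x :=
  or_congr_right (mem_skeleton_iff _)

lemma diagSkeleton_succ (n : ℕ) :
    diagSkeleton hS (n + 1) = diagSkeleton hS n ⊔ Subcomplex.range (attach Z n) := by
  ext d x
  refine (mem_diagSkeleton_iff hS x).trans
    (Iff.trans ?_ (or_congr_left (mem_diagSkeleton_iff hS x)).symm)
  rw [or_assoc]
  apply or_congr_right
  constructor
  · rintro ⟨m, hm, θ, z, rfl⟩
    obtain hm | rfl := Nat.lt_succ_iff_lt_or_eq.1 hm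
    · exact Or.inl ⟨m, hm, θ, z, rfl⟩
    · refine Or.inr ⟨(z, stdSimplex.objEquiv.symm θ.unop), ?_⟩
      exact attach_app_apply z θ.unop
  · rintro (⟨m, hm, θ, z, rfl⟩ | ⟨z, rfl⟩)
    · exact ⟨m, by lia, θ, z, rfl⟩
    · exact ⟨n, by lia, _, z.1, rfl⟩

lemma iSup_diagSkeleton : ⨆ n, diagSkeleton hS n = ⊤ := by
  rw [eq_top_iff]
  intro d x _
  simp only [Subfunctor.iSup_obj, Set.mem_iUnion]
  exact ⟨d.unop.len + 1, Or.inr (mem_skeleton (row Z d) x (by lia))⟩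

lemma mem_boundary_iff {n : ℕ} {d : SimplexCategoryᵒᵖ} (x : (Δ[n] : SSet.{0}).obj d) :
    x ∈ (boundary.{0} n).obj d ↔ ¬ Epi (stdSimplex.objEquiv x) := by
  rw [SimplexCategory.epi_iff_surjective]
  rfl

lemma exists_factorization_of_not_epi {d : SimplexCategory} {n : ℕ} (θ : d ⟶ ⦋n⦌)
    (h : ¬ Epi θ) : ∃ (m : ℕ) (_ : m < n) (α : d ⟶ ⦋m⦌) (β : ⦋m⦌ ⟶ ⦋n⦌), α ≫ β = θ := by
  rw [SimplexCategory.epi_iff_surjective] at h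
  obtain _ | n := n
  · exact (h fun x => ⟨0, Subsingleton.elim (α := Fin 1) _ _⟩).elim
  · obtain ⟨i, θ', rfl⟩ := SimplexCategory.eq_comp_δ_of_not_surjective θ h
    exact ⟨n, by lia, θ', _, rfl⟩

lemma mem_latching_unionProd_iff {n : ℕ} {d : SimplexCategoryᵒᵖ} (z : (Z _⦋n⦌).obj d)
    (θ : d.unop ⟶ ⦋n⦌) :
    ((z, stdSimplex.objEquiv.symm θ) : ((Z _⦋n⦌) ⊗ Δ[n]).obj d) ∈
        ((latching S n).unionProd ∂Δ[n]).obj d ↔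
      ¬ Epi θ ∨ z ∈ (S (.op ⦋n⦌)).obj d ∨ z ∈ (row Z d).degenerate n :=
  (Subcomplex.mem_unionProd_iff _ _ _).trans (or_congr
    ((mem_boundary_iff _).trans (by rw [Equiv.apply_symm_apply])) (mem_latching_iff S n d z))

lemma preimage_diagSkeleton (n : ℕ) :
    (diagSkeleton hS n).preimage (attach Z n) = (latching S n).unionProd ∂Δ[n] := by
  ext d ⟨z, τ⟩
  obtain ⟨θ, rfl⟩ := stdSimplex.objEquiv.symm.surjective τ
  refine Iff.trans ?_ (mem_latching_unionProd_iff z θ).symm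
  change (attach Z n).app d (z, stdSimplex.objEquiv.symm θ) ∈ (diagSkeleton hS n).obj d ↔ _
  rw [attach_app_apply]
  refine (mem_diagSkeleton_iff hS _).trans ?_
  constructor
  · intro h
    by_contra! h'
    obtain ⟨h₁, h₂, h₃⟩ := h'
    obtain ⟨⟨s, hs⟩⟩ := isSplitEpi_of_epi θ
    have hz : (row Z d).map s.op ((row Z d).map θ.op z) = z := by
      rw [← Functor.map_comp_apply, ← op_comp, hs]
      simp
    obtain h | ⟨m, hm, α, w, h⟩ := h
    · exact h₂ (hz ▸ hS s.op d _ h)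
    · refine h₃ ⟨m, hm, s ≫ α.unop, w, ?_⟩
      rw [← hz, ← h]
      simp
  · rintro (h | h | ⟨m, hm, f, w, rfl⟩)
    · obtain ⟨m, hm, α, β, rfl⟩ := exists_factorization_of_not_epi θ h
      exact Or.inr ⟨m, hm, α.op, (row Z d).map β.op z, by simp⟩
    · exact Or.inl (hS _ _ _ h)
    · exact Or.inr ⟨m, hm, f.op ≫ θ.op, w, by simp⟩

lemma acyclicLE_diagSkeleton (h : ∀ n, AcyclicLE (S n) ⊤) (n : ℕ) :
    AcyclicLE (diagSkeleton hS n) (diagSkeleton hS (n + 1)) := by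
  rw [diagSkeleton_succ]
  apply AcyclicLE.of_attach
  · rw [preimage_diagSkeleton]
    exact acyclic_pushoutObjObj (acyclic_latching_ι hS h n)
      (Subcomplex.unionProd.pushoutObjObj (latching S n) ∂Δ[n])
  · rw [preimage_diagSkeleton]
    rintro d ⟨z, τ⟩ ⟨z', τ'⟩ h₁ h₂ h₃
    obtain ⟨θ, rfl⟩ := stdSimplex.objEquiv.symm.surjective τ
    obtain ⟨θ', rfl⟩ := stdSimplex.objEquiv.symm.surjective τ'
    replace h₁ := (mem_latching_unionProd_iff z θ).not.1 h₁
    replace h₂ := (mem_latching_unionProd_iff z' θ').not.1 h₂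
    rw [not_or, not_or, not_not] at h₁ h₂
    replace h₃ := (attach_app_apply z θ).symm.trans (h₃.trans (attach_app_apply z' θ'))
    obtain ⟨hθ, -, hz⟩ := h₁
    obtain ⟨-, -, hz'⟩ := h₂
    have h₄ : z = z' := congrArg Subtype.val ((row Z d).unique_nonDegenerate_simplex _
      θ ⟨z, hz⟩ rfl θ' ⟨z', hz'⟩ h₃)
    subst h₄
    have h₅ : θ = θ' := (row Z d).unique_nonDegenerate_map _
      θ ⟨z, hz⟩ rfl θ' ⟨z, hz'⟩ h₃
    rw [h₅]

lemma acyclic_range_ι_iff {A B : SSet.{0}} (i : A ⟶ B) [Mono i] :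
    acyclic (Subcomplex.range i).ι ↔ acyclic i := by
  have : Mono (Subcomplex.toRange i) := mono_of_mono_fac (Subcomplex.toRange_ι i)
  have : IsIso (Subcomplex.toRange i) := isIso_of_mono_of_epi _
  exact (acyclic.arrow_mk_iso_iff (show Arrow.mk i ≅ Arrow.mk _ from
    Arrow.isoMk (@asIso _ _ _ _ _ this) (Iso.refl _) rfl)).symm

lemma diagMap_weakHomotopyEquivalence_of_mono {X Y : SimplicialObject SSet.{0}} (f : X ⟶ Y)
    [∀ n, Mono (f.app n)] (hf : ∀ n, WeakHomotopyEquivalence (f.app n)) :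
    WeakHomotopyEquivalence (diagMap f) := by
  let S (n : SimplexCategoryᵒᵖ) : (Y.obj n).Subcomplex := Subcomplex.range (f.app n)
  have hS : IsStableFamily S := by
    rintro n m φ d _ ⟨x, rfl⟩
    exact ⟨(X.map φ).app d x, ConcreteCategory.congr_hom (NatTrans.congr_app (f.naturality φ) d) x⟩
  have hS' (n) : AcyclicLE (S n) ⊤ := by
    rw [acyclicLE_top_iff, acyclic_range_ι_iff]
    exact (hf n).acyclic
  have h : acyclic (diagSkeleton hS 0).ι :=
    acyclic_of_filtration _ (acyclicLE_diagSkeleton hS hS') (iSup_diagSkeleton hS)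
  have hi (d : SimplexCategoryᵒᵖ) : Function.Injective ((f.app d).app d) :=
    injective_of_mono ((f.app d).app d)
  have : Mono (diagMap f) := by
    have (d : SimplexCategoryᵒᵖ) : Mono ((diagMap f).app d) := (mono_iff_injective _).2 (hi d)
    exact NatTrans.mono_of_mono_app _
  have e : diagSkeleton hS 0 = Subcomplex.range (diagMap f) := by
    ext d x
    exact (mem_diagSkeleton_iff hS x).trans (or_iff_left (by simp))
  rw [e, acyclic_range_ι_iff] at h
  exact h.weakHomotopyEquivalence

end Filtration

section Cone

open CartesianMonoidalCategory

lemma WeakHomotopyEquivalence.fst_of_contraction (B : SSet.{0}) {W : SSet.{0}}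
    (p : ∀ n, W.obj n) (hp : ∀ {n m} (φ : n ⟶ m), W.map φ (p n) = p m) (h : W ⊗ Δ[1] ⟶ W)
    (h₀ : ∀ n w, h.app n (w, stdSimplex.const 1 0 n) = w)
    (h₁ : ∀ n w, h.app n (w, stdSimplex.const 1 1 n) = p n)
    (h₂ : ∀ n τ, h.app n (p n, τ) = p n) :
    WeakHomotopyEquivalence (fst B W) := by
  let s : B ⟶ B ⊗ W :=
    { app n := ↾fun b => (b, p n)
      naturality n m φ := by
        refine ConcreteCategory.hom_ext _ _ fun b => ?_
        exact Prod.ext rfl (hp φ).symm }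
  refine .of_deformationRetract s _ rfl 1 0 ((α_ B W Δ[1]).hom ≫ B ◁ h) ?_ ?_ ?_
  · ext n ⟨b, w⟩
    exacts [rfl, h₁ n w]
  · ext n ⟨b, w⟩
    exacts [rfl, h₀ n w]
  · ext n ⟨b, τ⟩
    exacts [rfl, h₂ n τ]

/-- A functorial contractible simplicial set containing a given simplicial set. -/
def cone : SSet.{0} ⥤ SSet.{0} where
  obj T :=
    { obj n := ∀ a : SimplexCategory, (a ⟶ n.unop) → Option (T.obj (.op a))
      map φ := ↾fun x a θ => x a (θ ≫ φ.unop) }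
  map f := { app n := ↾fun x a θ => (x a θ).map (f.app (.op a)) }

/-- The embedding of a simplicial set into its cone. -/
def toCone : 𝟭 SSet.{0} ⟶ cone where
  app T :=
    { app n := ↾fun x a θ => some (T.map θ.op x)
      naturality n m φ := by
        refine ConcreteCategory.hom_ext _ _ fun x => ?_
        funext a θ
        exact congrArg some (Functor.map_comp_apply T φ θ.op x).symm }
  naturality T T' f := by
    ext n x
    funext a θ
    exact congrArg some (NatTrans.naturality_apply f θ.op x).symm

instance (T : SSet.{0}) : Mono (toCone.app T) := by
  have (n : SimplexCategoryᵒᵖ) : Mono ((toCone.app T).app n) := by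
    rw [mono_iff_injective]
    intro x y h
    have h' : some (T.map (𝟙 n) x) = some (T.map (𝟙 n) y) :=
      congrFun (congrFun h n.unop) (𝟙 n.unop)
    simpa using h'
  exact NatTrans.mono_of_mono_app _

open Classical in
/-- The contraction of the cone. -/
noncomputable def coneContraction (T : SSet.{0}) : cone.obj T ⊗ Δ[1] ⟶ cone.obj T where
  app n := ↾fun x a θ =>
    if (Δ[1] : SSet.{0}).map θ.op x.2 = stdSimplex.const 1 0 (.op a) then x.1 a θ else none
  naturality n m φ := by
    refine ConcreteCategory.hom_ext _ _ fun x => ?_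
    funext a θ
    change (if (Δ[1] : SSet.{0}).map θ.op ((Δ[1] : SSet.{0}).map φ x.2) = _ then _ else _) =
      if (Δ[1] : SSet.{0}).map (φ ≫ θ.op) x.2 = _ then _ else _
    rw [Functor.map_comp_apply]
    rfl

lemma coneContraction_const_zero (T : SSet.{0}) (n : SimplexCategoryᵒᵖ) (w : (cone.obj T).obj n) :
    (coneContraction T).app n (w, stdSimplex.const 1 0 n) = w := by
  funext a θ
  exact if_pos rfl

lemma coneContraction_const_one (T : SSet.{0}) (n : SimplexCategoryᵒᵖ) (w : (cone.obj T).obj n) :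
    (coneContraction T).app n (w, stdSimplex.const 1 1 n) = fun _ _ => none := by
  funext a θ
  refine if_neg fun h => ?_
  have := congrArg (fun τ => stdSimplex.asOrderHom τ 0) h
  exact absurd (show (1 : Fin 2) = 0 from this) (by simp)

lemma coneContraction_none (T : SSet.{0}) (n : SimplexCategoryᵒᵖ)
    (τ : (Δ[1] : SSet.{0}).obj n) :
    (coneContraction T).app n (fun _ _ => none, τ) = fun _ _ => none := by
  funext a θ
  exact ite_self _

lemma coneContraction_naturality {T T' : SSet.{0}} (f : T ⟶ T') :
    cone.map f ▷ Δ[1] ≫ coneContraction T' = coneContraction T ≫ cone.map f := by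
  ext n x
  funext a θ
  change (if (Δ[1] : SSet.{0}).map θ.op x.2 = _ then (x.1 a θ).map (f.app (.op a)) else none) =
    (if (Δ[1] : SSet.{0}).map θ.op x.2 = _ then x.1 a θ else none).map (f.app (.op a))
  split_ifs <;> rfl

/-- The contraction of the diagonal of the levelwise cone. -/
noncomputable def diagConeContraction (X : SimplicialObject SSet.{0}) :
    diag (X ⋙ cone) ⊗ Δ[1] ⟶ diag (X ⋙ cone) where
  app n := (coneContraction (X.obj n)).app n
  naturality n m φ := by
    refine ConcreteCategory.hom_ext _ _ fun x => ?_
    have h₁ := ConcreteCategory.congr_hom (NatTrans.congr_app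
      (coneContraction_naturality (X.map φ)) m) ((cone.obj (X.obj n) ⊗ Δ[1]).map φ x)
    have h₂ := NatTrans.naturality_apply (coneContraction (X.obj n)) φ x
    exact h₁.trans (congrArg ((cone.map (X.map φ)).app m) h₂)

end Cone

open CartesianMonoidalCategory

lemma diagMap_fst_weakHomotopyEquivalence (X : SimplicialObject SSet.{0})
    (Y : SimplexCategoryᵒᵖ ⥤ SSet.{0}) :
    WeakHomotopyEquivalence (diagMap (fst Y (X ⋙ cone))) := by
  have e : WeakHomotopyEquivalence (fst (diag Y) (diag (X ⋙ cone))) :=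
    WeakHomotopyEquivalence.fst_of_contraction (diag Y) (W := diag (X ⋙ cone))
      (fun n _ _ => none) (fun _ => rfl)
      (diagConeContraction X) (fun n => coneContraction_const_zero (X.obj n) n)
      (fun n => coneContraction_const_one (X.obj n) n)
      (fun n => coneContraction_none (X.obj n) n)
  exact e

/-- A levelwise weak homotopy equivalence induces a weak homotopy equivalence on diagonals. -/
theorem diagMap_weakHomotopyEquivalence {X Y : SimplexCategoryᵒᵖ ⥤ SSet.{0}} (f : X ⟶ Y)
    (h : ∀ k : SimplexCategoryᵒᵖ, WeakHomotopyEquivalence (f.app k)) :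
    WeakHomotopyEquivalence (diagMap f) := by
  let W : SimplexCategoryᵒᵖ ⥤ SSet.{0} := X ⋙ cone
  let i : X ⟶ Y ⊗ W := lift f (Functor.whiskerLeft X toCone)
  have hp (k) : WeakHomotopyEquivalence ((fst Y W).app k) :=
    .fst_of_contraction (Y.obj k) (W := cone.obj (X.obj k)) (fun n _ _ => none) (fun _ => rfl)
      (coneContraction (X.obj k)) (coneContraction_const_zero _) (coneContraction_const_one _)
      (coneContraction_none _)
  have hi (k) : WeakHomotopyEquivalence (i.app k) :=
    WeakHomotopyEquivalence.of_comp_left (g := (fst Y W).app k) (hp k) (h k)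
  have hm (k) : Mono (i.app k) := by
    have hk : i ≫ snd Y W = Functor.whiskerLeft X toCone := lift_snd _ _
    have : Mono ((Functor.whiskerLeft X toCone).app k) :=
      inferInstanceAs (Mono (toCone.app (X.obj k)))
    exact mono_of_mono_fac (NatTrans.congr_app hk k)
  have h₁ : WeakHomotopyEquivalence (diagMap i) := diagMap_weakHomotopyEquivalence_of_mono i hi
  have h₂ : WeakHomotopyEquivalence (diagMap (fst Y W)) :=
    diagMap_fst_weakHomotopyEquivalence X Y
  have e : i ≫ fst Y W = f := lift_fst f (Functor.whiskerLeft X toCone)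
  have e' : diagMap (i ≫ fst Y W) = diagMap i ≫ diagMap (fst Y W) := rfl
  rw [← e, e']
  exact h₁.comp h₂

end Paper

/-- A levelwise weak homotopy equivalence of bisimplicial sets induces
a weak homotopy equivalence on diagonals. -/
theorem diagonal_weakHomotopyEquivalence {X Y : SimplicialObject SSet.{0}} (f : X ⟶ Y)
    (h : ∀ k : SimplexCategoryᵒᵖ, Paper.WeakHomotopyEquivalence (f.app k)) :
    Paper.WeakHomotopyEquivalence (Paper.diagMap f) := by
  exact Paper.diagMap_weakHomotopyEquivalence f h
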